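/- Let G be a finite simple graph on n vertices. If for every subset S of the vertex set of G the number of odd components of G − S is at most |S| + 1, then G has a matching of size ⌊n/2⌋ (a near-perfect matching). -/

import Mathlib

/-- A matching of a simple graph `G`: a set of edges of `G` such that no two distinct
edges of the set share a vertex. -/
def IsGraphMatching {V : Type*} (G : SimpleGraph V) (M : Set (Sym2 V)) : Prop :=
  M ⊆ G.edgeSet ∧ M.Pairwise (fun e f => ∀ v : V, v ∈ e → v ∉ f)

/-- The number of odd components of `G − S`, i.e. of connected components of the
subgraph of `G` induced on the complement of `S` having an odd number of vertices. -/
noncomputable def oddComponents {V : Type*} (G : SimpleGraph V) (S : Set V) : ℕ :=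
  Set.ncard {C : (G.induce (Sᶜ : Set V)).ConnectedComponent | Odd C.supp.ncard}

open SimpleGraph in
lemma iso_odd_ncard {V W : Type*} {G : SimpleGraph V} {H : SimpleGraph W} (e : G ≃g H) :
    G.oddComponents.ncard = H.oddComponents.ncard := by
  have key : ∀ C : G.ConnectedComponent, (e.connectedComponentEquiv C).supp.ncard = C.supp.ncard := by
    intro C
    have : (e.connectedComponentEquiv C).supp = e '' C.supp := by
      ext w
      obtain ⟨v, rfl⟩ := e.surjective w
      induction C using ConnectedComponent.ind with
      | h c =>
        simp [Iso.connectedComponentEquiv, ConnectedComponent.mem_supp_iff, ConnectedComponent.eq,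
          Iso.reachable_iff]
    rw [this, Set.ncard_image_of_injective _ e.injective]
  have : H.oddComponents = e.connectedComponentEquiv '' G.oddComponents := by
    ext C
    obtain ⟨C, rfl⟩ := e.connectedComponentEquiv.surjective C
    rw [e.connectedComponentEquiv.injective.mem_set_image]
    change Odd _ ↔ Odd _
    rw [key]
  rw [this, Set.ncard_image_of_injective _ e.connectedComponentEquiv.injective]

/-- Deleting vertices from the top subgraph is the same as inducing on the complement. -/
def deleteIso {V : Type*} (G : SimpleGraph V) (U : Set V) :
    ((⊤ : G.Subgraph).deleteVerts U).coe ≃g G.induce (Uᶜ : Set V) where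
  toFun x := ⟨x.1, by have := x.2; simp at this; exact this⟩
  invFun x := ⟨x.1, ⟨trivial, x.2⟩⟩
  left_inv x := rfl
  right_inv x := rfl
  map_rel_iff' := by
    rintro ⟨a, ha⟩ ⟨b, hb⟩
    simp at ha hb
    simp [ha, hb]

lemma violator_iff {V : Type*} (G : SimpleGraph V) (U : Set V) :
    G.IsTutteViolator U ↔ U.ncard < oddComponents G U := by
  have := iso_odd_ncard (deleteIso G U)
  unfold SimpleGraph.IsTutteViolator oddComponents
  rw [this]

lemma parity {V : Type*} [Fintype V] (G : SimpleGraph V) (U : Set V)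
    (hev : Even (Fintype.card V)) : (Odd (oddComponents G U) ↔ Odd U.ncard) := by
  have h1 := (G.induce (Uᶜ : Set V)).odd_ncard_oddComponents
  have h2 := Set.ncard_add_ncard_compl U
  rw [Nat.card_eq_fintype_card] at h2
  rw [Nat.card_coe_set_eq] at h1
  unfold oddComponents
  refine h1.trans ?_
  rw [← h2] at hev
  grind

lemma of_graph {V : Type*} [Fintype V] (G D : SimpleGraph V) (hD : D ≤ G)
    (h1 : ∀ v a b, D.Adj v a → D.Adj v b → a = b)
    (h2 : ∀ v w, (∀ a, ¬ D.Adj v a) → (∀ a, ¬ D.Adj w a) → v = w) :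
    ∃ M : Set (Sym2 V), IsGraphMatching G M ∧ M.ncard = Fintype.card V / 2 := by
  classical
  refine ⟨D.edgeSet, ⟨SimpleGraph.edgeSet_mono hD, ?_⟩, ?_⟩
  · intro e he f hf hne v hve hvf
    obtain ⟨a, rfl⟩ := hve
    obtain ⟨b, rfl⟩ := hvf
    exact hne (by rw [h1 v a b he hf])
  · have hs := D.sum_degrees_eq_twice_card_edges
    rw [← SimpleGraph.coe_edgeFinset, Set.ncard_coe_finset]
    have hdeg : ∀ v, D.degree v = if (∀ a, ¬ D.Adj v a) then 0 else 1 := by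
      intro v
      split_ifs with hv
      · rw [SimpleGraph.degree, Finset.card_eq_zero]
        ext a; simp [hv]
      · push Not at hv
        obtain ⟨a, ha⟩ := hv
        rw [SimpleGraph.degree, Finset.card_eq_one]
        refine ⟨a, ?_⟩
        ext b
        simp only [SimpleGraph.mem_neighborFinset, Finset.mem_singleton]
        exact ⟨fun hb => h1 v b a hb ha, fun hb => hb ▸ ha⟩
    have hc : (Finset.univ.filter (fun v => ∀ a, ¬ D.Adj v a)).card ≤ 1 := by
      rw [Finset.card_le_one]
      intro v hv w hw
      simp only [Finset.mem_filter, Finset.mem_univ, true_and] at hv hw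
      exact h2 v w hv hw
    have hsum := Finset.card_filter_add_card_filter_not (s := (Finset.univ : Finset V))
      (fun v => ∀ a, ¬ D.Adj v a)
    have : ∑ v, D.degree v = (Finset.univ.filter (fun v => ¬ ∀ a, ¬ D.Adj v a)).card := by
      rw [Finset.card_filter]
      refine Finset.sum_congr rfl fun v _ => ?_
      rw [hdeg v]
      split_ifs <;> simp_all
    rw [Finset.card_univ] at hsum
    omega

/-- The cone over a graph. -/
def coneGraph {V : Type*} (G : SimpleGraph V) : SimpleGraph (Option V) where
  Adj x y := x ≠ y ∧ ∀ a b, x = some a → y = some b → G.Adj a b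
  symm := ⟨fun x y h => ⟨h.1.symm, fun a b ha hb => (h.2 b a hb ha).symm⟩⟩
  loopless := ⟨fun x h => h.1 rfl⟩

/-- Deleting the apex. -/
def coneIso {V : Type*} (G : SimpleGraph V) (U : Set (Option V)) (hU : none ∈ U) :
    G.induce ((some ⁻¹' U)ᶜ : Set V) ≃g (coneGraph G).induce (Uᶜ : Set (Option V)) where
  toFun x := ⟨some x.1, x.2⟩
  invFun x := ⟨x.1.get (by
    obtain ⟨x | x, hx⟩ := x
    · exact absurd hU hx
    · rfl), by
    obtain ⟨x | x, hx⟩ := x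
    · exact absurd hU hx
    · exact hx⟩
  left_inv x := rfl
  right_inv x := by simp
  map_rel_iff' := by
    rintro ⟨a, ha⟩ ⟨b, hb⟩
    simp only [coneGraph, SimpleGraph.comap_adj]
    simp
    intro h
    exact h.ne

lemma cone_no_violator {V : Type*} [Fintype V] (G : SimpleGraph V)
    (h : ∀ S : Set V, oddComponents G S ≤ S.ncard + 1) (hodd : Odd (Fintype.card V))
    (U : Set (Option V)) : ¬ (coneGraph G).IsTutteViolator U := by
  rw [violator_iff, not_lt]
  by_cases hU : none ∈ U
  · have e := iso_odd_ncard (coneIso G U hU)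
    have h1 := h (some ⁻¹' U)
    have h2 : U = insert none (some '' (some ⁻¹' U)) := by
      ext x
      cases x <;> simp [hU]
    have h3 : U.ncard = (some ⁻¹' U).ncard + 1 := by
      conv_lhs => rw [h2]
      rw [Set.ncard_insert_of_notMem (by simp),
        Set.ncard_image_of_injective _ (Option.some_injective V)]
    rw [h3]
    refine le_trans (le_of_eq ?_) h1
    exact e.symm
  · have hp := parity (coneGraph G) U (by rw [Fintype.card_option]; exact hodd.add_one)
    have hle : oddComponents (coneGraph G) U ≤ 1 := by
      have hC : ∀ C : ((coneGraph G).induce (Uᶜ : Set (Option V))).ConnectedComponent,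
          C = SimpleGraph.connectedComponentMk _ ⟨none, hU⟩ := by
        intro C
        induction C using SimpleGraph.ConnectedComponent.ind with
        | h c =>
          rw [SimpleGraph.ConnectedComponent.eq]
          by_cases hc : c = ⟨none, hU⟩
          · rw [hc]
          · refine SimpleGraph.Adj.reachable ?_
            refine ⟨fun h => hc (Subtype.ext h), ?_⟩
            intro a b _ hb
            exact absurd hb (by simp)
      unfold oddComponents
      rw [Set.ncard_le_one_iff]
      intro a b _ _
      rw [hC a, hC b]
    by_contra! hlt
    have h1 : oddComponents (coneGraph G) U = 1 := by omega
    have h0 : U.ncard = 0 := by omega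
    rw [h1, h0] at hp
    simp at hp

/-- if for every vertex subset `S` of a finite simple graph `G` on `n`
vertices the number of odd components of `G − S` is at most `|S| + 1`, then `G` has a
matching of size `⌊n/2⌋`, i.e. a near-perfect matching. -/
theorem statement9 {V : Type*} [Fintype V] (G : SimpleGraph V)
    (h : ∀ S : Set V, oddComponents G S ≤ S.ncard + 1) :
    ∃ M : Set (Sym2 V), IsGraphMatching G M ∧ M.ncard = Fintype.card V / 2 := by
  rcases Nat.even_or_odd (Fintype.card V) with hev | hodd
  · obtain ⟨M, hM⟩ := (SimpleGraph.tutte (G := G)).2 (by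
      intro U
      rw [violator_iff, not_lt]
      have hp := parity G U hev
      have := h U
      grind)
    refine of_graph G M.spanningCoe M.spanningCoe_le ?_ ?_
    · intro v a b ha hb
      exact (hM.1 (M.edge_vert ha)).unique ha hb
    · intro v w hv
      obtain ⟨a, ha, _⟩ := hM.1 (hM.2 v)
      exact absurd ha (hv a)
  · obtain ⟨M, hM⟩ := (SimpleGraph.tutte (G := coneGraph G)).2 (cone_no_violator G h hodd)
    have hun : ∀ x a b, M.Adj x a → M.Adj x b → a = b := fun x a b ha hb =>
      (hM.1 (M.edge_vert ha)).unique ha hb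
    refine of_graph G (M.spanningCoe.comap some) ?_ ?_ ?_
    · intro a b hab
      exact (M.adj_sub hab).2 a b rfl rfl
    · intro v a b ha hb
      exact Option.some_injective _ (hun _ _ _ ha hb)
    · have key : ∀ v, (∀ a, ¬ (M.spanningCoe.comap some).Adj v a) → M.Adj none (some v) := by
        intro v hv
        obtain ⟨a, ha, _⟩ := hM.1 (hM.2 (some v))
        cases a with
        | none => exact ha.symm
        | some a => exact absurd ha (hv a)
      intro v w hv hw
      exact Option.some_injective _ (hun _ _ _ (key v hv) (key w hw))
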